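/- Let n ≥ 1 and let c : [0,1]^n → {1, …, n} be a measurable selection rule that depends only on the relative order of the coordinates, i.e., c(x) = c(x') whenever the points x and x' (each with pairwise distinct coordinates) induce the same ranking: x_i < x_j if and only if x'_i < x'_j for all i, j. Then the probability (under Lebesgue product measure on [0,1]^n) that the selected value x_{c(x)} is the best, i.e., |x_{c(x)} − 1/2| ≤ |x_i − 1/2| for all i, is at most C(n−1, ⌊(n−1)/2⌋) / 2^(n−1). -/

import Mathlib

open MeasureTheory

/-- The uniform probability measure on the cube `[0,1]^n`. -/
noncomputable def unifCube (n : ℕ) : Measure (Fin n → ℝ) :=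
  Measure.pi fun _ => volume.restrict (Set.Icc 0 1)

/-- Reflect the coordinates with index in `E` about `1/2`. -/
def reflectCoords {n : ℕ} (E : Finset (Fin n)) (x : Fin n → ℝ) : Fin n → ℝ :=
  fun i => if i ∈ E then 1 - x i else x i

theorem abs_reflectCoords_sub_half {n : ℕ} (E : Finset (Fin n)) (x : Fin n → ℝ) (i : Fin n) :
    |reflectCoords E x i - 1/2| = |x i - 1/2| := by
  unfold reflectCoords
  split_ifs
  · rw [← abs_neg]; congr 1; ring
  · rfl

instance isProbabilityMeasure_unifCube (n : ℕ) : IsProbabilityMeasure (unifCube n) := by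
  have : IsProbabilityMeasure (volume.restrict (Set.Icc (0 : ℝ) 1)) := ⟨by simp⟩
  unfold unifCube
  infer_instance

theorem measurePreserving_reflectCoords {n : ℕ} (E : Finset (Fin n)) :
    MeasurePreserving (reflectCoords E) (unifCube n) (unifCube n) := by
  have hrefl : MeasurePreserving (fun t : ℝ => 1 - t) (volume.restrict (Set.Icc 0 1))
      (volume.restrict (Set.Icc 0 1)) := by
    have h := (Measure.measurePreserving_sub_left (volume : Measure ℝ) 1).restrict_preimage
      (measurableSet_Icc (a := (0 : ℝ)) (b := 1))
    simpa using h
  refine measurePreserving_pi (fun _ => volume.restrict (Set.Icc (0 : ℝ) 1))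
    (fun _ => volume.restrict (Set.Icc (0 : ℝ) 1))
    (f := fun i t => if i ∈ E then 1 - t else t) fun i => ?_
  by_cases hi : i ∈ E
  · simpa [hi] using hrefl
  · simp only [hi, if_false]
    exact MeasurePreserving.id _

theorem measurePreserving_comp_perm {n : ℕ} (σ : Equiv.Perm (Fin n)) :
    MeasurePreserving (fun x : Fin n → ℝ => x ∘ σ) (unifCube n) (unifCube n) := by
  have h := measurePreserving_piCongrLeft
    (fun _ : Fin n => (volume.restrict (Set.Icc (0 : ℝ) 1))) σ.symm
  unfold unifCube
  convert h using 1
  ext x i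
  simp [MeasurableEquiv.piCongrLeft, Equiv.piCongrLeft, Equiv.piCongrLeft']

theorem ae_injective_unifCube (n : ℕ) : ∀ᵐ x ∂unifCube n, Function.Injective x := by
  have hac : unifCube n ≪ volume := by
    unfold unifCube
    rw [← Measure.restrict_pi_pi]
    exact Measure.restrict_le_self.absolutelyContinuous
  refine hac.ae_le ?_
  have hne : ∀ i j : Fin n, i ≠ j → ∀ᵐ x : Fin n → ℝ, x i ≠ x j := by
    intro i j hij
    have h := Measure.addHaar_submodule (volume : Measure (Fin n → ℝ))
      (LinearMap.eqLocus (LinearMap.proj (R := ℝ) (φ := fun _ : Fin n => ℝ) i)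
        (LinearMap.proj j)) (by
        intro htop
        have hmem : (Pi.single i 1 : Fin n → ℝ) ∈ (⊤ : Submodule ℝ (Fin n → ℝ)) := trivial
        rw [← htop, LinearMap.mem_eqLocus] at hmem
        simp [hij.symm] at hmem)
    rw [ae_iff]
    convert h using 2
    ext x
    simp
  have hall : ∀ᵐ x : Fin n → ℝ, ∀ i j, i ≠ j → x i ≠ x j := by
    simp only [ae_all_iff]
    exact hne
  filter_upwards [hall] with x hx i j hij
  by_contra h
  exact hx i j h hij

theorem ae_injective_abs_sub_half (n : ℕ) :
    ∀ᵐ x ∂unifCube n, Function.Injective fun i => |x i - 1/2| := by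
  have h : ∀ᵐ x ∂unifCube n, ∀ E, Function.Injective (reflectCoords E x) :=
    ae_all_iff.2 fun E => (measurePreserving_reflectCoords E).quasiMeasurePreserving.ae
      (ae_injective_unifCube n)
  filter_upwards [h] with x hx i j hij
  by_contra hne
  rcases abs_eq_abs.1 hij with h1 | h1
  · exact hne (hx ∅ (by simp only [reflectCoords]; simp; linarith))
  · refine hne (hx {i} ?_)
    simp only [reflectCoords, Finset.mem_singleton, if_true, if_neg (Ne.symm hne)]
    linarith

theorem card_filter_card_erase_le {α : Type*} [Fintype α] [DecidableEq α] (j : α) (r : ℕ) :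
    (Finset.univ.filter fun E : Finset α => (E.erase j).card = r).card ≤
      2 * (Fintype.card α - 1).choose ((Fintype.card α - 1) / 2) := by
  calc _ ≤ ((Finset.univ : Finset Bool) ×ˢ
        Finset.powersetCard r (Finset.univ.erase j)).card := by
        refine Finset.card_le_card_of_injOn (fun E => (decide (j ∈ E), E.erase j)) ?_ ?_
        · intro E hE
          simp only [Finset.coe_filter, Finset.mem_univ, true_and, Set.mem_ofPred_eq] at hE
          simp [Finset.mem_powersetCard, hE, Finset.erase_subset_erase, em]
        · intro E _ F _ h
          simp only [Prod.mk.injEq, decide_eq_decide] at h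
          ext i
          by_cases hi : i = j
          · rw [hi]; exact h.1
          · simpa [hi] using Finset.ext_iff.1 h.2 i
    _ = 2 * (Fintype.card α - 1).choose r := by
        simp [Finset.card_product, Finset.card_powersetCard]
    _ ≤ _ := Nat.mul_le_mul_left _ (Nat.choose_le_middle _ _)

/-- The number of coordinates of `x` strictly below the `j`-th one. -/
noncomputable def coordRank {n : ℕ} (x : Fin n → ℝ) (j : Fin n) : ℕ :=
  (Finset.univ.filter fun i => x i < x j).card

theorem strictMono_comp_sort {n : ℕ} {y : Fin n → ℝ} (hy : Function.Injective y) :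
    StrictMono (y ∘ Tuple.sort y) :=
  (Tuple.monotone_sort y).strictMono_of_injective (hy.comp (Tuple.sort y).injective)

theorem coordRank_sort {n : ℕ} {y : Fin n → ℝ} (hy : Function.Injective y) (k : Fin n) :
    coordRank y (Tuple.sort y k) = k := by
  have h : (Finset.univ.filter fun i => y i < y (Tuple.sort y k)) =
      (Finset.Iio k).map (Tuple.sort y).toEmbedding := by
    ext i
    obtain ⟨l, rfl⟩ := (Tuple.sort y).surjective i
    simpa using (strictMono_comp_sort hy).lt_iff_lt (a := l) (b := k)
  rw [coordRank, h, Finset.card_map, Fin.card_Iio]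

theorem card_filter_coordRank_reflectCoords_le {n : ℕ} {x : Fin n → ℝ} {j : Fin n}
    (hj : ∀ i, i ≠ j → |x j - 1/2| < |x i - 1/2|) (r : ℕ) :
    (Finset.univ.filter fun E => coordRank (reflectCoords E x) j = r).card ≤
      2 * (n - 1).choose ((n - 1) / 2) := by
  set A : Finset (Fin n) := Finset.univ.filter fun i => x i < 1/2 with hA
  have hrank : ∀ E, coordRank (reflectCoords E x) j = ((symmDiff E A).erase j).card := by
    intro E
    unfold coordRank
    congr 1
    ext i
    by_cases hij : i = j
    · simp [hij]
    have hlt := hj i hij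
    rw [← abs_reflectCoords_sub_half E, ← abs_reflectCoords_sub_half E x i] at hlt
    have hside : reflectCoords E x i < reflectCoords E x j ↔ reflectCoords E x i < 1/2 := by
      constructor
      · intro h
        by_contra! h'
        rw [abs_of_nonneg (sub_nonneg.2 h')] at hlt
        linarith [le_abs_self (reflectCoords E x j - 1/2)]
      · intro h
        rw [abs_of_neg (sub_neg.2 h)] at hlt
        linarith [neg_abs_le (reflectCoords E x j - 1/2)]
    have hxi : x i ≠ 1/2 := by
      intro h
      have := hj i hij
      rw [h, sub_self, abs_zero] at this
      exact absurd this (abs_nonneg _).not_gt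
    simp only [Finset.mem_filter, Finset.mem_univ, true_and, hside, Finset.mem_erase, ne_eq, hij,
      not_false_eq_true, Finset.mem_symmDiff, hA]
    unfold reflectCoords
    split_ifs with hi
    · simp only [hi, true_and, not_true_eq_false, and_false, or_false, not_lt]
      constructor
      · intro h; linarith
      · intro h; linarith [lt_of_le_of_ne h hxi.symm]
    · simp [hi]
  refine le_trans (Finset.card_le_card_of_injOn (fun E => symmDiff E A) ?_ ?_)
    ((card_filter_card_erase_le j r).trans_eq (by rw [Fintype.card_fin]))
  · intro E hE
    simpa [hrank] using hE
  · intro E _ F _ h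
    exact symmDiff_left_injective A h

theorem card_filter_selector_success_le {n : ℕ} {c : (Fin n → ℝ) → Fin n}
    (hrank : ∀ x x' : Fin n → ℝ, Function.Injective x → Function.Injective x' →
      (∀ i j, x i < x j ↔ x' i < x' j) → c x = c x')
    {x : Fin n → ℝ} {j : Fin n} (hj : ∀ i, i ≠ j → |x j - 1/2| < |x i - 1/2|)
    (hx : Function.Injective fun i => |x i - 1/2|) :
    ∑ E : Finset (Fin n), (Finset.univ.filter fun σ : Equiv.Perm (Fin n) =>
        σ (c (reflectCoords E x ∘ σ)) = j).card ≤
      n.factorial * (2 * (n - 1).choose ((n - 1) / 2)) := by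
  set C : Equiv.Perm (Fin n) → Fin n := fun τ => c fun i => ((τ i : ℕ) : ℝ)
  have hinj : ∀ E, Function.Injective (reflectCoords E x) := by
    intro E a b hab
    apply hx
    change |x a - 1/2| = |x b - 1/2|
    rw [← abs_reflectCoords_sub_half E, hab, abs_reflectCoords_sub_half]
  have hcount : ∀ E, (Finset.univ.filter fun σ : Equiv.Perm (Fin n) =>
        σ (c (reflectCoords E x ∘ σ)) = j).card ≤
      (Finset.univ.filter fun τ : Equiv.Perm (Fin n) =>
        coordRank (reflectCoords E x) j = τ (C τ)).card := by
    intro E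
    set y := reflectCoords E x
    refine Finset.card_le_card_of_injOn (fun σ => (Tuple.sort y)⁻¹ * σ) ?_
      fun σ _ σ' _ h => mul_left_cancel h
    intro σ hσ
    simp only [Finset.coe_filter, Finset.mem_univ, true_and, Set.mem_ofPred_eq] at hσ ⊢
    obtain ⟨τ, rfl⟩ : ∃ τ, σ = Tuple.sort y * τ := ⟨(Tuple.sort y)⁻¹ * σ, by simp⟩
    have hC : c (y ∘ (Tuple.sort y * τ : Equiv.Perm (Fin n))) = C τ := by
      refine hrank _ _ ((hinj E).comp (Equiv.injective _)) ?_ fun a b => ?_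
      · intro a b hab
        exact τ.injective (Fin.ext (Nat.cast_injective hab))
      · have := (strictMono_comp_sort (hinj E)).lt_iff_lt (a := τ a) (b := τ b)
        simpa using this
    rw [hC] at hσ
    rw [inv_mul_cancel_left, ← hσ]
    exact coordRank_sort (hinj E) _
  calc _ ≤ ∑ E : Finset (Fin n), (Finset.univ.filter fun τ : Equiv.Perm (Fin n) =>
        coordRank (reflectCoords E x) j = τ (C τ)).card := Finset.sum_le_sum fun E _ => hcount E
    _ = ∑ τ : Equiv.Perm (Fin n), (Finset.univ.filter fun E =>
        coordRank (reflectCoords E x) j = τ (C τ)).card := by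
      simp only [Finset.card_filter]
      exact Finset.sum_comm
    _ ≤ ∑ _τ : Equiv.Perm (Fin n), 2 * (n - 1).choose ((n - 1) / 2) :=
      Finset.sum_le_sum fun τ _ => card_filter_coordRank_reflectCoords_le hj _
    _ = _ := by simp [Fintype.card_perm]

theorem measurableSet_selector_success {n : ℕ} {c : (Fin n → ℝ) → Fin n} (hc : Measurable c) :
    MeasurableSet {x : Fin n → ℝ | ∀ i, |x (c x) - 1/2| ≤ |x i - 1/2|} := by
  have h : {x : Fin n → ℝ | ∀ i, |x (c x) - 1/2| ≤ |x i - 1/2|} =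
      ⋃ k, c ⁻¹' {k} ∩ ⋂ i, {x | |x k - 1/2| ≤ |x i - 1/2|} := by
    ext x
    simp
  rw [h]
  refine MeasurableSet.iUnion fun k => (hc (measurableSet_singleton k)).inter
    (MeasurableSet.iInter fun i => measurableSet_le ?_ ?_) <;> fun_prop

/-- Hindsight upper bound: if `c` is a measurable selection rule depending only on the
relative order of the coordinates (points with pairwise distinct coordinates inducing the
same ranking get the same selected index), then the probability that the selected value is
closest to `1/2` is at most `C(n-1, ⌊(n-1)/2⌋) / 2^(n-1)`. -/
theorem rank_selector_upper_bound (n : ℕ) (hn : 1 ≤ n)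
    (c : (Fin n → ℝ) → Fin n) (hc : Measurable c)
    (hrank : ∀ x x' : Fin n → ℝ, Function.Injective x → Function.Injective x' →
      (∀ i j, x i < x j ↔ x' i < x' j) → c x = c x') :
    unifCube n {x | ∀ i, |x (c x) - 1/2| ≤ |x i - 1/2|} ≤
      ENNReal.ofReal (((n - 1).choose ((n - 1) / 2) : ℝ) / 2 ^ (n - 1)) := by
  classical
  set S := {x : Fin n → ℝ | ∀ i, |x (c x) - 1/2| ≤ |x i - 1/2|}
  have hSm : MeasurableSet S := measurableSet_selector_success hc
  have hmp : ∀ (E : Finset (Fin n)) (σ : Equiv.Perm (Fin n)),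
      MeasurePreserving (fun x => reflectCoords E x ∘ σ) (unifCube n) (unifCube n) := fun E σ =>
    (measurePreserving_comp_perm σ).comp (measurePreserving_reflectCoords E)
  have hbound : ∀ᵐ x ∂unifCube n, ∑ E : Finset (Fin n), ∑ σ : Equiv.Perm (Fin n),
      S.indicator (1 : (Fin n → ℝ) → ENNReal) (reflectCoords E x ∘ σ) ≤
        ((n.factorial * (2 * (n - 1).choose ((n - 1) / 2)) : ℕ) : ENNReal) := by
    filter_upwards [ae_injective_abs_sub_half n] with x hx
    have : Nonempty (Fin n) := ⟨⟨0, hn⟩⟩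
    obtain ⟨j, hj⟩ := Finite.exists_min fun i => |x i - 1/2|
    have hj' : ∀ i, i ≠ j → |x j - 1/2| < |x i - 1/2| := fun i hi =>
      lt_of_le_of_ne (hj i) fun h => hi (hx h.symm)
    refine le_trans ?_ (Nat.cast_le.2 (card_filter_selector_success_le hrank hj' hx))
    simp only [Finset.card_filter, Nat.cast_sum]
    refine Finset.sum_le_sum fun E _ => Finset.sum_le_sum fun σ _ => ?_
    by_cases hmem : reflectCoords E x ∘ σ ∈ S
    · have hsel : σ (c (reflectCoords E x ∘ σ)) = j := by
        by_contra hne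
        have h1 := hmem (σ.symm j)
        simp only [Function.comp_apply, Equiv.apply_symm_apply, abs_reflectCoords_sub_half] at h1
        exact absurd h1 (hj' _ hne).not_ge
      simp [hmem, hsel]
    · simp [hmem]
  have hint : ∫⁻ x, ∑ E : Finset (Fin n), ∑ σ : Equiv.Perm (Fin n),
      S.indicator (1 : (Fin n → ℝ) → ENNReal) (reflectCoords E x ∘ σ) ∂unifCube n =
        ((2 ^ n * n.factorial : ℕ) : ENNReal) * unifCube n S := by
    have hmeas : Measurable (S.indicator (1 : (Fin n → ℝ) → ENNReal)) :=
      measurable_one.indicator hSm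
    have hmeas' : ∀ (E : Finset (Fin n)) (σ : Equiv.Perm (Fin n)), Measurable fun x =>
        S.indicator (1 : (Fin n → ℝ) → ENNReal) (reflectCoords E x ∘ σ) := fun E σ =>
      hmeas.comp (hmp E σ).measurable
    rw [lintegral_finsetSum _ fun E _ => Finset.measurable_sum _ fun σ _ => hmeas' E σ]
    have hone : ∀ E : Finset (Fin n), ∫⁻ x, ∑ σ : Equiv.Perm (Fin n),
        S.indicator (1 : (Fin n → ℝ) → ENNReal) (reflectCoords E x ∘ σ) ∂unifCube n =
          n.factorial * unifCube n S := by
      intro E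
      rw [lintegral_finsetSum _ fun σ _ => hmeas' E σ]
      simp [fun σ => (hmp E σ).lintegral_comp hmeas, lintegral_indicator_one hSm,
        Fintype.card_perm]
    simp [hone, mul_assoc]
  have hmain : ((2 ^ n * n.factorial : ℕ) : ENNReal) * unifCube n S ≤
      ((n.factorial * (2 * (n - 1).choose ((n - 1) / 2)) : ℕ) : ENNReal) := by
    rw [← hint]
    refine (lintegral_mono_ae hbound).trans ?_
    simp
  have hreal : (2 : ℝ) ^ n * n.factorial * (unifCube n).real S ≤
      n.factorial * (2 * (n - 1).choose ((n - 1) / 2)) := by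
    have := ENNReal.toReal_mono (ENNReal.natCast_ne_top _) hmain
    simpa [ENNReal.toReal_mul, Measure.real] using this
  rw [← ofReal_measureReal]
  refine ENNReal.ofReal_le_ofReal ?_
  rw [le_div_iff₀ (by positivity)]
  obtain ⟨m, rfl⟩ : ∃ m, n = m + 1 := ⟨n - 1, by omega⟩
  have hfac : (0 : ℝ) < 2 * (m + 1).factorial := by positivity
  refine le_of_mul_le_mul_left ?_ hfac
  simp only [Nat.add_sub_cancel] at hreal ⊢
  rw [pow_succ] at hreal
  linarith
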